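/- For each d ∈ ℤ_+, each t ≥ 15 and each ξ ∈ 𝕋^d one has F_{ℤ^d} g_t(ξ) ≤ exp(-πt|ξ|²/10). -/

import Mathlib

open scoped ENNReal Real BigOperators
open Real

/-- The one-dimensional Theta function `θ_t(ζ) = Σ_{k∈ℤ} exp(-π(k-ζ)²t)`. -/
noncomputable def theta (t ζ : ℝ) : ℝ :=
  ∑' k : ℤ, Real.exp (-π * ((k : ℝ) - ζ) ^ 2 * t)

/-- The d-dimensional Theta function `Θ_t(ξ) = Π_j θ_t(ξ_j)`. -/
noncomputable def bigTheta (d : ℕ) (t : ℝ) (ξ : Fin d → ℝ) : ℝ :=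
  ∏ j, theta t (ξ j)

/-- The discrete normalized Gaussian kernel `g_t(n) = Θ_{1/t}(0)⁻¹ exp(-π|n|²/t)`. -/
noncomputable def gauss (d : ℕ) (t : ℝ) (n : Fin d → ℤ) : ℝ :=
  (bigTheta d (1 / t) 0)⁻¹ * Real.exp (-π * (∑ j, ((n j : ℝ)) ^ 2) / t)

/-- The convolution operator `G_t f(x) = Σ_n g_t(n) f(x-n)` on ℤ^d. -/
noncomputable def gConv (d : ℕ) (t : ℝ) (f : (Fin d → ℤ) → ℂ) (x : Fin d → ℤ) : ℂ :=
  ∑' n : Fin d → ℤ, (gauss d t n : ℂ) * f (x - n)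

/-- The ℓ^p norm (valued in ℝ≥0∞) of an ℝ≥0∞-valued function on ℤ^d. -/
noncomputable def lpNorm (d : ℕ) (p : ℝ) (F : (Fin d → ℤ) → ℝ≥0∞) : ℝ≥0∞ :=
  (∑' x : Fin d → ℤ, F x ^ p) ^ (1 / p)

lemma aux_w : HasSum (fun k : ℤ => (1/2 : ℝ) ^ k.natAbs) 3 := by
  have h1 : HasSum (fun n : ℕ => (1/2 : ℝ) ^ ((n : ℤ)).natAbs) 2 := by
    simpa using hasSum_geometric_two
  have h2 : HasSum (fun n : ℕ => (1/2 : ℝ) ^ (-((n : ℤ) + 1)).natAbs) 1 := by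
    have h := (hasSum_geometric_two).mul_left (1/2 : ℝ)
    have e : (fun n : ℕ => (1/2 : ℝ) ^ (-((n : ℤ) + 1)).natAbs)
        = fun n : ℕ => (1/2 : ℝ) * (1/2 : ℝ) ^ n := by
      funext n
      have : (-((n : ℤ) + 1)).natAbs = n + 1 := by omega
      rw [this, pow_succ]; ring
    have e2 : (1/2 : ℝ) * 2 = 1 := by norm_num
    rw [e2] at h
    rw [e]
    exact h
  have h := HasSum.of_nat_of_neg_add_one (f := fun k : ℤ => (1/2 : ℝ) ^ k.natAbs) h1 h2
  have e3 : (2 : ℝ) + 1 = 3 := by norm_num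
  rw [e3] at h
  exact h

lemma aux_cosh (y : ℝ) (hy : 0 ≤ y) : Real.cosh y - 1 ≤ y ^ 2 * Real.exp y / 2 := by
  have h1 : 1 - y ≤ Real.exp (-y) := by have := Real.add_one_le_exp (-y); linarith
  have he : Real.exp y * Real.exp (-y) = 1 := by rw [← Real.exp_add]; simp
  have hp := Real.exp_pos y
  have hq : Real.exp (-y) ≤ 1 := Real.exp_le_one_iff.mpr (by linarith)
  rw [Real.cosh_eq]
  have h2 : (1 - Real.exp (-y)) ^ 2 ≤ y ^ 2 :=
    pow_le_pow_left₀ (by linarith) (by linarith) 2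
  have h3 : Real.exp y * (1 - Real.exp (-y)) ^ 2 ≤ Real.exp y * y ^ 2 :=
    mul_le_mul_of_nonneg_left h2 hp.le
  have h4 : Real.exp y * (1 - Real.exp (-y)) ^ 2
      = Real.exp y - 2 * (Real.exp y * Real.exp (-y)) +
        (Real.exp y * Real.exp (-y)) * Real.exp (-y) := by ring
  rw [h4, he] at h3
  linarith

lemma aux_half : Real.exp (-1) ≤ 1 / 2 := by
  have := Real.add_one_le_exp (1 : ℝ)
  rw [Real.exp_neg, one_div]
  exact inv_anti₀ (by norm_num) (by linarith)

lemma aux_pow (n : ℕ) : Real.exp (-(n : ℝ)) ≤ (1/2 : ℝ) ^ n := by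
  have : Real.exp (-(n : ℝ)) = (Real.exp (-1)) ^ n := by
    rw [← Real.exp_nat_mul]; congr 1; ring
  rw [this]
  exact pow_le_pow_left₀ (Real.exp_pos _).le aux_half n

lemma aux_e2 : (7 : ℝ) ≤ Real.exp (81/32) := by
  have := Real.quadratic_le_exp_of_nonneg (x := 81/64) (by norm_num)
  have h : Real.exp (81/32) = Real.exp (81/64) ^ 2 := by
    rw [← Real.exp_nat_mul]; congr 1; norm_num
  rw [h]
  nlinarith

lemma aux_big (s x : ℝ) (n : ℕ) (hs : 45 ≤ s) (hx0 : 0 ≤ x) (hx : x ≤ 1/2) :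
    Real.exp (-s * (n : ℝ) ^ 2) * (Real.cosh (2 * s * n * x) - 1) ≤ 2 * (1/2 : ℝ) ^ n := by
  rcases Nat.eq_zero_or_pos n with rfl | hn
  · simp
  have hn' : (1 : ℝ) ≤ n := by exact_mod_cast hn
  have hc : Real.cosh (2 * s * n * x) - 1 ≤ Real.exp (2 * s * n * x) := by
    have h0 : 0 ≤ 2 * s * n * x := by positivity
    have : Real.exp (-(2 * s * n * x)) ≤ Real.exp (2 * s * n * x) :=
      Real.exp_le_exp.mpr (by linarith)
    rw [Real.cosh_eq]; linarith
  calc _ ≤ Real.exp (-s * (n : ℝ) ^ 2) * Real.exp (2 * s * n * x) :=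
        mul_le_mul_of_nonneg_left hc (Real.exp_pos _).le
    _ = Real.exp (-s * (n : ℝ) ^ 2 + 2 * s * n * x) := by rw [Real.exp_add]
    _ ≤ Real.exp (-((n - 1 : ℕ) : ℝ)) := by
        apply Real.exp_le_exp.mpr
        push_cast [hn]
        have h1 : s * n * (2 * x) ≤ s * n * 1 :=
          mul_le_mul_of_nonneg_left (by linarith) (by positivity)
        have h2 : 1 * 1 * ((n : ℝ) - 1) ≤ s * n * ((n : ℝ) - 1) :=
          mul_le_mul_of_nonneg_right (by nlinarith) (by linarith)
        nlinarith
    _ ≤ (1/2 : ℝ) ^ (n - 1) := aux_pow _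
    _ = 2 * (1/2 : ℝ) ^ n := by
        obtain ⟨m, rfl⟩ : ∃ m, n = m + 1 := ⟨n - 1, by omega⟩
        simp [pow_succ]; ring

lemma aux_small (s x : ℝ) (n : ℕ) (hs : 45 ≤ s) (hx0 : 0 ≤ x) (hx : x ≤ 1/4) :
    Real.exp (-s * (n : ℝ) ^ 2) * (Real.cosh (2 * s * n * x) - 1)
      ≤ (3/10 * s * x ^ 2) * (1/2 : ℝ) ^ n := by
  rcases Nat.eq_zero_or_pos n with rfl | hn
  · simp; positivity
  have hn' : (1 : ℝ) ≤ n := by exact_mod_cast hn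
  have hc := aux_cosh (2 * s * n * x) (by positivity)
  set y := s * (n : ℝ) ^ 2 / 4 with hy
  have hy1 : 11 * (n : ℝ) ≤ y := by rw [hy]; nlinarith
  have e1 : Real.exp (-s * (n : ℝ) ^ 2) * Real.exp (2 * s * n * x) ≤
      Real.exp (-y) * Real.exp (-y) := by
    rw [← Real.exp_add, ← Real.exp_add]
    apply Real.exp_le_exp.mpr
    have h1 : s * n * (2 * x) ≤ s * n * (n / 2) :=
      mul_le_mul_of_nonneg_left (by linarith) (by positivity)
    rw [hy]; nlinarith
  have e2 : y * Real.exp (-y) ≤ 1 := by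
    have h1 : y ≤ Real.exp y := by have := Real.add_one_le_exp y; linarith
    calc y * Real.exp (-y) ≤ Real.exp y * Real.exp (-y) :=
          mul_le_mul_of_nonneg_right h1 (Real.exp_pos _).le
      _ = 1 := by rw [← Real.exp_add]; simp
  have e3 : Real.exp (-y) ≤ (1/32) * (1/2 : ℝ) ^ n := by
    calc Real.exp (-y) ≤ Real.exp (-((5 + n : ℕ) : ℝ)) := by
          apply Real.exp_le_exp.mpr; push_cast; linarith
      _ ≤ (1/2 : ℝ) ^ (5 + n) := aux_pow _
      _ = _ := by rw [pow_add]; norm_num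
  have e4 : y * (Real.exp (-y) * Real.exp (-y)) ≤ (1/32) * (1/2 : ℝ) ^ n := by
    calc _ = (y * Real.exp (-y)) * Real.exp (-y) := by ring
      _ ≤ 1 * Real.exp (-y) := mul_le_mul_of_nonneg_right e2 (Real.exp_pos _).le
      _ ≤ _ := by rw [one_mul]; exact e3
  have hpw : 0 < (1/2 : ℝ) ^ n := by positivity
  calc _ ≤ Real.exp (-s * (n : ℝ) ^ 2) * ((2 * s * n * x) ^ 2 * Real.exp (2 * s * n * x) / 2) :=
        mul_le_mul_of_nonneg_left hc (Real.exp_pos _).le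
    _ = (8 * s * x ^ 2 * y) * (Real.exp (-s * (n : ℝ) ^ 2) * Real.exp (2 * s * n * x)) := by
        rw [hy]; ring
    _ ≤ (8 * s * x ^ 2 * y) * (Real.exp (-y) * Real.exp (-y)) :=
        mul_le_mul_of_nonneg_left e1 (by positivity)
    _ = (8 * s * x ^ 2) * (y * (Real.exp (-y) * Real.exp (-y))) := by ring
    _ ≤ (8 * s * x ^ 2) * ((1/32) * (1/2 : ℝ) ^ n) :=
        mul_le_mul_of_nonneg_left e4 (by positivity)
    _ ≤ _ := by
        have : 0 ≤ s * x ^ 2 * (1/2 : ℝ) ^ n := by positivity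
        nlinarith

lemma aux_natAbs (s ζ : ℝ) (k : ℤ) :
    Real.exp (-s * (k : ℝ) ^ 2) * (Real.cosh (2 * s * k * ζ) - 1) =
    Real.exp (-s * ((k.natAbs : ℕ) : ℝ) ^ 2) *
      (Real.cosh (2 * s * (k.natAbs : ℕ) * |ζ|) - 1) := by
  have h : ((k.natAbs : ℕ) : ℝ) = |(k : ℝ)| := by
    rw [Nat.cast_natAbs]; push_cast; rfl
  rw [h, sq_abs]
  congr 2
  rw [← Real.cosh_abs (2 * s * k * ζ), ← Real.cosh_abs (2 * s * |(k : ℝ)| * |ζ|)]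
  simp [abs_mul]

lemma theta_bound (t ζ : ℝ) (ht : 15 ≤ t) (hz : |ζ| ≤ 1/2) :
    0 < theta t 0 ∧ theta t ζ ≤ theta t 0 * Real.exp (-π * t * ζ ^ 2 / 10) := by
  obtain ⟨s, hsdef⟩ : ∃ s, s = π * t := ⟨_, rfl⟩
  have hs : 45 ≤ s := by have := Real.pi_gt_three; rw [hsdef]; nlinarith
  have hx0 := abs_nonneg ζ
  set F : ℤ → ℝ := fun k => Real.exp (-s * (k : ℝ) ^ 2) * (Real.cosh (2 * s * k * ζ) - 1) with hF
  set G : ℤ → ℝ := fun k => Real.exp (-s * (k : ℝ) ^ 2) with hG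
  have hF0 : ∀ k, 0 ≤ F k := fun k =>
    mul_nonneg (Real.exp_pos _).le (by have := Real.one_le_cosh (2 * s * k * ζ); linarith)
  have hFle : ∀ k, F k ≤ 2 * (1/2 : ℝ) ^ k.natAbs := fun k => by
    simp only [hF]; rw [aux_natAbs]; exact aux_big s |ζ| _ hs hx0 hz
  have hFs : Summable F := Summable.of_nonneg_of_le hF0 hFle (aux_w.summable.mul_left 2)
  have hGs : Summable G := by
    refine Summable.of_nonneg_of_le (fun k => (Real.exp_pos _).le) (fun k => ?_) aux_w.summable
    refine le_trans ?_ (aux_pow _)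
    apply Real.exp_le_exp.mpr
    have h : ((k.natAbs : ℕ) : ℝ) = |(k : ℝ)| := by
      rw [Nat.cast_natAbs]; push_cast; rfl
    have h2 : ((k.natAbs : ℕ) : ℝ) ≤ (k.natAbs : ℝ) ^ 2 := by
      exact_mod_cast Nat.le_self_pow (by norm_num) k.natAbs
    rw [← sq_abs (k : ℝ), ← h]
    nlinarith [sq_nonneg ((k.natAbs : ℕ) : ℝ)]
  have hG1 : 1 ≤ ∑' k, G k := by
    have := hGs.le_tsum 0 (fun k _ => (Real.exp_pos _).le)
    simpa [hG] using this
  have hth0 : theta t 0 = ∑' k, G k := by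
    unfold theta
    apply tsum_congr; intro k
    simp only [hG, hsdef]; congr 1; ring
  have hFsum : ∑' k, F k ≤ Real.exp (9/10 * s * ζ ^ 2) - 1 := by
    rcases le_total |ζ| (1/4) with h | h
    · have h1 : ∀ k, F k ≤ (3/10 * s * |ζ| ^ 2) * (1/2 : ℝ) ^ k.natAbs := fun k => by
        simp only [hF]; rw [aux_natAbs]; exact aux_small s |ζ| _ hs hx0 h
      have h2 := hFs.tsum_le_tsum h1 (aux_w.summable.mul_left _)
      rw [tsum_mul_left, aux_w.tsum_eq, sq_abs] at h2
      have := Real.add_one_le_exp (9/10 * s * ζ ^ 2)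
      linarith
    · have h2 := hFs.tsum_le_tsum hFle (aux_w.summable.mul_left _)
      rw [tsum_mul_left, aux_w.tsum_eq] at h2
      have h3 : (81/32 : ℝ) ≤ 9/10 * s * ζ ^ 2 := by
        rw [← sq_abs ζ]
        have : (1/16 : ℝ) ≤ |ζ| ^ 2 := by nlinarith
        nlinarith
      have := aux_e2.trans (Real.exp_le_exp.mpr h3)
      linarith
  -- symmetrisation
  set H : ℤ → ℝ := fun k => Real.exp (-π * ((k : ℝ) - ζ) ^ 2 * t) with hH
  have hsym : ∀ k, H k + H (-k) = 2 * Real.exp (-s * ζ ^ 2) * (F k + G k) := by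
    intro k
    have a1 : H k = Real.exp (-s * ζ ^ 2) * Real.exp (-s * (k : ℝ) ^ 2) *
        Real.exp (2 * s * k * ζ) := by
      simp only [hH]; rw [← Real.exp_add, ← Real.exp_add, hsdef]; congr 1; ring
    have a2 : H (-k) = Real.exp (-s * ζ ^ 2) * Real.exp (-s * (k : ℝ) ^ 2) *
        Real.exp (-(2 * s * k * ζ)) := by
      simp only [hH]; rw [← Real.exp_add, ← Real.exp_add, hsdef]; congr 1; push_cast; ring
    rw [a1, a2]; simp only [hF, hG]; rw [Real.cosh_eq]; ring
  have hHH : Summable (fun k => H k + H (-k)) := by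
    simp_rw [hsym]; exact (hFs.add hGs).mul_left _
  have hHs : Summable H := Summable.of_nonneg_of_le (fun k => (Real.exp_pos _).le)
    (fun k => by have : 0 < H (-k) := Real.exp_pos _
                 linarith) hHH
  have hHn : Summable (fun k => H (-k)) := (Equiv.neg ℤ).summable_iff.mpr hHs
  have hHe : ∑' k, H (-k) = ∑' k, H k := (Equiv.neg ℤ).tsum_eq H
  have hth : theta t ζ = Real.exp (-s * ζ ^ 2) * (∑' k, F k + ∑' k, G k) := by
    have h1 := hHs.tsum_add hHn
    simp_rw [hsym] at h1
    rw [tsum_mul_left, hFs.tsum_add hGs, hHe] at h1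
    have : theta t ζ = ∑' k, H k := rfl
    rw [this]; linarith
  refine ⟨by rw [hth0]; linarith, ?_⟩
  rw [hth, hth0]
  have hE : Real.exp (-π * t * ζ ^ 2 / 10) =
      Real.exp (-s * ζ ^ 2) * Real.exp (9/10 * s * ζ ^ 2) := by
    rw [← Real.exp_add, hsdef]; congr 1; ring
  rw [hE]
  have hE1 : 1 ≤ Real.exp (9/10 * s * ζ ^ 2) := Real.one_le_exp (by positivity)
  have hfin : ∑' k, F k + ∑' k, G k ≤ (∑' k, G k) * Real.exp (9/10 * s * ζ ^ 2) := by
    nlinarith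
  calc _ ≤ Real.exp (-s * ζ ^ 2) * ((∑' k, G k) * Real.exp (9/10 * s * ζ ^ 2)) :=
        mul_le_mul_of_nonneg_left hfin (Real.exp_pos _).le
    _ = _ := by ring

/-- Estimate at infinity, large scales: for `d ∈ ℤ_+`, `t ≥ 15` and `ξ ∈ 𝕋^d` one has
`F_{ℤ^d} g_t(ξ) = Θ_t(ξ)/Θ_t(0) ≤ exp(-πt|ξ|²/10)`. -/
theorem fourier_gauss_large_scales (d : ℕ) (hd : 0 < d) (t : ℝ) (ht : 15 ≤ t)
    (ξ : Fin d → ℝ) (hξ : ∀ j, ξ j ∈ Set.Ico (-(1/2) : ℝ) (1/2)) :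
    bigTheta d t ξ / bigTheta d t 0 ≤ Real.exp (-π * t * (∑ j, ξ j ^ 2) / 10) := by
  have hb : ∀ j, 0 < theta t 0 ∧
      theta t (ξ j) ≤ theta t 0 * Real.exp (-π * t * (ξ j) ^ 2 / 10) := fun j =>
    theta_bound t (ξ j) ht (abs_le.mpr ⟨by have := (hξ j).1; linarith, (hξ j).2.le⟩)
  have hE : Real.exp (-π * t * (∑ j, ξ j ^ 2) / 10) =
      ∏ j, Real.exp (-π * t * (ξ j) ^ 2 / 10) := by
    rw [← Real.exp_sum, Finset.mul_sum, Finset.sum_div]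
  rw [hE]
  unfold bigTheta
  simp only [Pi.zero_apply]
  rw [div_le_iff₀ (Finset.prod_pos fun j _ => (hb j).1), ← Finset.prod_mul_distrib]
  refine Finset.prod_le_prod (fun j _ => tsum_nonneg fun k => (Real.exp_pos _).le) fun j _ => ?_
  rw [mul_comm]
  exact (hb j).2
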